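/- Let p, q ∈ (1, ∞) be conjugate exponents (1/p + 1/q = 1). Let ‖·‖ be a norm on ℝ^k with dual norm ‖y‖_* = sup_{‖x‖ ≤ 1} ⟨x, y⟩, and let h : ℝ^k → ℝ^k be a Borel map satisfying ⟨h(y), y⟩ = ‖y‖_* for all y and ‖h(y)‖ = 1 for all y ≠ 0. Let l : ℝ^k → ℝ be Lipschitz continuous and continuously differentiable, and let μ be a probability measure on ℝ^k with finite p-th moment such that Υ := (∫ ‖∇l(x)‖_*^q dμ(x))^{1/q} > 0. For δ ≥ 0 let η_δ be the pushforward of μ under the map T_δ(x) = x + δ · h(∇l(x)) ‖∇l(x)‖_*^{q−1} Υ^{1−q}, and define V(δ) = sup { ∫ l dη : η a probability measure on ℝ^k with W_p(μ, η) ≤ δ }. Then V(δ) = ∫ l dη_δ + o(δ) as δ ↓ 0. -/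

import Mathlib

open MeasureTheory Filter
open scoped ENNReal NNReal

noncomputable section

/-- The standard inner product pairing on `ℝ^k`. -/
def pairing {k : ℕ} (x y : Fin k → ℝ) : ℝ := ∑ i, x i * y i

/-- `nrm` is a norm on `ℝ^k`. -/
structure IsNorm {k : ℕ} (nrm : (Fin k → ℝ) → ℝ) : Prop where
  triangle : ∀ x y, nrm (x + y) ≤ nrm x + nrm y
  smul : ∀ (c : ℝ) (x : Fin k → ℝ), nrm (c • x) = |c| * nrm x
  pos : ∀ x, x ≠ 0 → 0 < nrm x

/-- The dual norm `‖y‖_* = sup_{‖x‖ ≤ 1} ⟨x, y⟩`. -/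
def dualNorm {k : ℕ} (nrm : (Fin k → ℝ) → ℝ) (y : Fin k → ℝ) : ℝ :=
  sSup {r | ∃ x, nrm x ≤ 1 ∧ r = pairing x y}

/-- The gradient of `l : ℝ^k → ℝ` with respect to the standard basis. -/
def grad {k : ℕ} (l : (Fin k → ℝ) → ℝ) (x : Fin k → ℝ) : Fin k → ℝ :=
  fun i => fderiv ℝ l x (Pi.single i 1)

/-- The `p`-Wasserstein distance (with respect to the norm `nrm`), as an
infimum over all couplings of `μ` and `ν`. -/
def Wp {k : ℕ} (p : ℝ) (nrm : (Fin k → ℝ) → ℝ) (μ ν : Measure (Fin k → ℝ)) : ℝ≥0∞ :=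
  ⨅ (π : Measure ((Fin k → ℝ) × (Fin k → ℝ))) (_ : IsProbabilityMeasure π)
    (_ : π.map Prod.fst = μ) (_ : π.map Prod.snd = ν),
    (∫⁻ z, ENNReal.ofReal (nrm (z.1 - z.2) ^ p) ∂π) ^ (1 / p)

/-- The robust value `V(δ) = sup { ∫ l dη : W_p(μ, η) ≤ δ }`. -/
def Vrob {k : ℕ} (p : ℝ) (nrm : (Fin k → ℝ) → ℝ) (l : (Fin k → ℝ) → ℝ)
    (μ : Measure (Fin k → ℝ)) (δ : ℝ) : ℝ :=
  sSup {r | ∃ η : Measure (Fin k → ℝ), IsProbabilityMeasure η ∧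
    Wp p nrm μ η ≤ ENNReal.ofReal δ ∧ r = ∫ x, l x ∂η}

namespace IsNorm

variable {k : ℕ} {nrm : (Fin k → ℝ) → ℝ}

lemma map_zero (hn : IsNorm nrm) : nrm 0 = 0 := by
  simpa using hn.smul 0 0

lemma map_neg (hn : IsNorm nrm) (x : Fin k → ℝ) : nrm (-x) = nrm x := by
  simpa using hn.smul (-1) x

lemma nonneg (hn : IsNorm nrm) (x : Fin k → ℝ) : 0 ≤ nrm x := by
  rcases eq_or_ne x 0 with rfl | hx
  · exact hn.map_zero.ge
  · exact (hn.pos x hx).le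

lemma map_sub_rev (hn : IsNorm nrm) (x y : Fin k → ℝ) : nrm (x - y) = nrm (y - x) := by
  rw [← neg_sub, hn.map_neg]

lemma map_sum_le (hn : IsNorm nrm) {ι : Type*} (s : Finset ι) (f : ι → Fin k → ℝ) :
    nrm (∑ i ∈ s, f i) ≤ ∑ i ∈ s, nrm (f i) :=
  Finset.le_sum_of_subadditive nrm hn.map_zero.le hn.triangle s f

lemma exists_le_mul_norm (hn : IsNorm nrm) : ∃ C : ℝ≥0, ∀ x, nrm x ≤ C * ‖x‖ := by
  refine ⟨⟨∑ i, nrm (Pi.single i 1), Finset.sum_nonneg fun i _ => hn.nonneg _⟩, fun x => ?_⟩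
  calc nrm x = nrm (∑ i, x i • Pi.single i (1 : ℝ)) := by rw [← pi_eq_sum_univ' x]
    _ ≤ ∑ i, nrm (x i • Pi.single i (1 : ℝ)) := hn.map_sum_le _ _
    _ ≤ ∑ i, nrm (Pi.single i 1) * ‖x‖ := Finset.sum_le_sum fun i _ => by
        rw [hn.smul, mul_comm]
        exact mul_le_mul_of_nonneg_left (norm_le_pi_norm x i) (hn.nonneg _)
    _ = _ := by rw [← Finset.sum_mul]; rfl

lemma continuous (hn : IsNorm nrm) : Continuous nrm := by
  obtain ⟨C, hC⟩ := hn.exists_le_mul_norm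
  refine (LipschitzWith.of_le_add_mul C fun x y => ?_).continuous
  have h := hn.triangle y (x - y)
  rw [add_sub_cancel] at h
  rw [dist_eq_norm]
  linarith [hC (x - y)]

lemma exists_norm_le_mul (hn : IsNorm nrm) : ∃ C : ℝ, 0 < C ∧ ∀ x, ‖x‖ ≤ C * nrm x := by
  rcases (Metric.sphere (0 : Fin k → ℝ) 1).eq_empty_or_nonempty with he | hne
  · refine ⟨1, one_pos, fun x => ?_⟩
    rcases eq_or_ne x 0 with rfl | hx
    · simp [hn.map_zero]
    · have : ‖x‖⁻¹ • x ∈ Metric.sphere (0 : Fin k → ℝ) 1 := by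
        simp [norm_smul, norm_ne_zero_iff.2 hx]
      simp [he] at this
  · obtain ⟨z, hz, hmin⟩ := (isCompact_sphere (0 : Fin k → ℝ) 1).exists_isMinOn hne
      hn.continuous.continuousOn
    have hz0 : z ≠ 0 := by
      rintro rfl
      simp at hz
    have hpos := hn.pos z hz0
    refine ⟨(nrm z)⁻¹, inv_pos.2 hpos, fun x => ?_⟩
    rcases eq_or_ne x 0 with rfl | hx
    · simp [hn.map_zero]
    · have hxn : 0 < ‖x‖ := norm_pos_iff.2 hx
      have : nrm z ≤ nrm (‖x‖⁻¹ • x) := hmin (by simp [norm_smul, hxn.ne'])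
      rw [hn.smul, abs_of_pos (inv_pos.2 hxn)] at this
      rw [inv_mul_eq_div, le_div_iff₀ hpos]
      calc ‖x‖ * nrm z ≤ ‖x‖ * (‖x‖⁻¹ * nrm x) := by gcongr
        _ = nrm x := by field_simp

end IsNorm

lemma abs_pairing_le {k : ℕ} (x y : Fin k → ℝ) : |pairing x y| ≤ ‖x‖ * (k * ‖y‖) := by
  calc |pairing x y| ≤ ∑ i, |x i * y i| := Finset.abs_sum_le_sum_abs _ _
    _ ≤ ∑ _i : Fin k, ‖x‖ * ‖y‖ := Finset.sum_le_sum fun i _ => by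
        rw [abs_mul]
        exact mul_le_mul (norm_le_pi_norm x i) (norm_le_pi_norm y i) (abs_nonneg _)
          (norm_nonneg _)
    _ = _ := by simp; ring

lemma pairing_smul_left {k : ℕ} (c : ℝ) (x y : Fin k → ℝ) :
    pairing (c • x) y = c * pairing x y := by
  simp [pairing, Finset.mul_sum, mul_assoc]

section DualNorm

variable {k : ℕ} {nrm : (Fin k → ℝ) → ℝ}

lemma bddAbove_dualNorm (hn : IsNorm nrm) (y : Fin k → ℝ) :
    BddAbove {r | ∃ x, nrm x ≤ 1 ∧ r = pairing x y} := by
  obtain ⟨C, hC, hle⟩ := hn.exists_norm_le_mul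
  refine ⟨C * (k * ‖y‖), ?_⟩
  rintro r ⟨x, hx, rfl⟩
  calc pairing x y ≤ ‖x‖ * (k * ‖y‖) := (le_abs_self _).trans (abs_pairing_le x y)
    _ ≤ C * (k * ‖y‖) := by
        gcongr
        exact (hle x).trans (mul_le_of_le_one_right hC.le hx)

lemma dualNorm_nonneg (hn : IsNorm nrm) (y : Fin k → ℝ) : 0 ≤ dualNorm nrm y :=
  le_csSup (bddAbove_dualNorm hn y) ⟨0, by simp [hn.map_zero], by simp [pairing]⟩

lemma pairing_le_mul_dualNorm (hn : IsNorm nrm) (x y : Fin k → ℝ) :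
    pairing x y ≤ dualNorm nrm y * nrm x := by
  rcases eq_or_ne x 0 with rfl | hx
  · simp [pairing, hn.map_zero]
  · have hpos := hn.pos x hx
    have : pairing ((nrm x)⁻¹ • x) y ≤ dualNorm nrm y :=
      le_csSup (bddAbove_dualNorm hn y)
        ⟨_, by rw [hn.smul, abs_of_pos (inv_pos.2 hpos), inv_mul_cancel₀ hpos.ne'], rfl⟩
    rwa [pairing_smul_left, inv_mul_le_iff₀ hpos, mul_comm] at this

lemma exists_dualNorm_le (hn : IsNorm nrm) : ∃ C : ℝ, 0 ≤ C ∧ ∀ y, dualNorm nrm y ≤ C * ‖y‖ := by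
  obtain ⟨C, hC, hle⟩ := hn.exists_norm_le_mul
  refine ⟨C * k, by positivity, fun y => csSup_le ⟨_, 0, by simp [hn.map_zero], rfl⟩ ?_⟩
  rintro r ⟨x, hx, rfl⟩
  calc pairing x y ≤ ‖x‖ * (k * ‖y‖) := (le_abs_self _).trans (abs_pairing_le x y)
    _ ≤ C * (k * ‖y‖) := by
        gcongr
        exact (hle x).trans (mul_le_of_le_one_right hC.le hx)
    _ = C * k * ‖y‖ := by ring

end DualNorm

section Gradient

variable {k : ℕ} {l : (Fin k → ℝ) → ℝ}

lemma pairing_grad (x v : Fin k → ℝ) : pairing v (grad l x) = fderiv ℝ l x v := by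
  conv_rhs => rw [pi_eq_sum_univ' v]
  simp [pairing, grad]

lemma continuous_grad (hl : ContDiff ℝ 1 l) : Continuous (grad l) :=
  continuous_pi fun _ => (hl.continuous_fderiv one_ne_zero).clm_apply continuous_const

lemma norm_grad_le {K : ℝ≥0} (hl : LipschitzWith K l) (x : Fin k → ℝ) : ‖grad l x‖ ≤ K := by
  refine (pi_norm_le_iff_of_nonneg K.2).2 fun i => ?_
  calc ‖fderiv ℝ l x (Pi.single i 1)‖ ≤ ‖fderiv ℝ l x‖ * ‖(Pi.single i 1 : Fin k → ℝ)‖ :=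
        ContinuousLinearMap.le_opNorm _ _
    _ ≤ K * 1 := by
        gcongr
        · exact norm_fderiv_le_of_lipschitz ℝ hl
        · simp [Pi.norm_single]
    _ = K := mul_one _

/-- The error of the first-order expansion of `l` at `x`, evaluated at `y`. -/
def taylorRem (l : (Fin k → ℝ) → ℝ) (x y : Fin k → ℝ) : ℝ :=
  l y - l x - pairing (y - x) (grad l x)

lemma continuous_taylorRem (hl : ContDiff ℝ 1 l) :
    Continuous fun z : (Fin k → ℝ) × (Fin k → ℝ) => taylorRem l z.1 z.2 := by
  have := hl.continuous
  have hg := continuous_grad hl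
  unfold taylorRem pairing
  fun_prop

lemma abs_taylorRem_le_of_lipschitz {K : ℝ≥0} (hlip : LipschitzWith K l) (x y : Fin k → ℝ) :
    |taylorRem l x y| ≤ 2 * K * ‖y - x‖ := by
  rw [taylorRem, pairing_grad]
  have h1 : |l y - l x| ≤ K * ‖y - x‖ := by
    simpa [← Real.dist_eq, ← dist_eq_norm] using hlip.dist_le_mul y x
  have h2 : |fderiv ℝ l x (y - x)| ≤ K * ‖y - x‖ :=
    (fderiv ℝ l x).le_of_opNorm_le (norm_fderiv_le_of_lipschitz ℝ hlip) _
  linarith [abs_sub (l y - l x) (fderiv ℝ l x (y - x))]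

lemma exists_abs_taylorRem_le_of_isCompact (hl : ContDiff ℝ 1 l) {s : Set (Fin k → ℝ)}
    (hs : IsCompact s) {ε : ℝ} (hε : 0 < ε) :
    ∃ r > 0, ∀ x ∈ s, ∀ y, ‖y - x‖ < r → |taylorRem l x y| ≤ ε * ‖y - x‖ := by
  have hunif := hs.uniformContinuousAt_of_continuousAt (fderiv ℝ l)
    (fun a _ => (hl.continuous_fderiv one_ne_zero).continuousAt) (Metric.dist_mem_uniformity hε)
  obtain ⟨r, hr, hsub⟩ := Metric.mem_uniformity_dist.1 hunif
  refine ⟨r, hr, fun x hx y hy => ?_⟩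
  rw [taylorRem, pairing_grad]
  refine (convex_ball x r).norm_image_sub_le_of_norm_fderiv_le'
    (𝕜 := ℝ) (f := l) (φ := fderiv ℝ l x) (fun z _ => hl.differentiable one_ne_zero z)
    (fun z hz => ?_) (Metric.mem_ball_self hr) (by simpa [dist_eq_norm] using hy)
  have := hsub (a := x) (b := z) (by rwa [dist_comm]) hx
  rw [← dist_eq_norm, dist_comm]
  exact le_of_lt this

/-- Small displacements from a compact set contribute `ε`, large displacements are absorbed by
their `p`-th power. -/
lemma exists_abs_taylorRem_le {nrm : (Fin k → ℝ) → ℝ} (hn : IsNorm nrm) (hl : ContDiff ℝ 1 l)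
    {K : ℝ≥0} (hlip : LipschitzWith K l) {p : ℝ} (hp : 1 < p) :
    ∃ M : ℝ, 0 ≤ M ∧ ∀ s : Set (Fin k → ℝ), IsCompact s → ∀ ε > 0, ∃ D : ℝ, 0 ≤ D ∧ ∀ x y,
      |taylorRem l x y| ≤ ε * nrm (x - y) + M * (sᶜ.indicator 1 x * nrm (x - y))
        + D * nrm (x - y) ^ p := by
  obtain ⟨C, hC, hle⟩ := hn.exists_norm_le_mul
  refine ⟨2 * K * C, by positivity, fun s hs ε hε => ?_⟩
  obtain ⟨r, hr, hloc⟩ := exists_abs_taylorRem_le_of_isCompact hl hs (div_pos hε hC)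
  refine ⟨2 * K * (C ^ p / r ^ (p - 1)), by positivity, fun x y => ?_⟩
  have hN := hn.nonneg (x - y)
  have hxy : ‖y - x‖ ≤ C * nrm (x - y) := by rw [norm_sub_rev]; exact hle _
  have hglob := abs_taylorRem_le_of_lipschitz hlip x y
  have hind : (0 : ℝ) ≤ sᶜ.indicator 1 x := Set.indicator_nonneg (fun _ _ => zero_le_one) x
  by_cases hx : x ∈ s
  · rcases lt_or_ge ‖y - x‖ r with hlt | hge
    · calc |taylorRem l x y| ≤ ε / C * ‖y - x‖ := hloc x hx y hlt
        _ ≤ ε / C * (C * nrm (x - y)) := by gcongr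
        _ = ε * nrm (x - y) := by field_simp
        _ ≤ _ := by rw [add_assoc]; exact le_add_of_nonneg_right (by positivity)
    · have key : ‖y - x‖ ≤ C ^ p / r ^ (p - 1) * nrm (x - y) ^ p := by
        have hpos : 0 < ‖y - x‖ := hr.trans_le hge
        rw [div_mul_eq_mul_div, le_div_iff₀ (by positivity), ← Real.mul_rpow hC.le hN]
        calc ‖y - x‖ * r ^ (p - 1) ≤ ‖y - x‖ * ‖y - x‖ ^ (p - 1) := by gcongr
          _ = ‖y - x‖ ^ p := by rw [Real.rpow_sub_one hpos.ne']; field_simp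
          _ ≤ _ := by gcongr
      calc |taylorRem l x y| ≤ 2 * K * ‖y - x‖ := hglob
        _ ≤ 2 * K * (C ^ p / r ^ (p - 1) * nrm (x - y) ^ p) := by gcongr
        _ = 2 * K * (C ^ p / r ^ (p - 1)) * nrm (x - y) ^ p := by ring
        _ ≤ _ := le_add_of_nonneg_left (by positivity)
  · have : sᶜ.indicator (1 : (Fin k → ℝ) → ℝ) x = 1 := by simp [hx]
    rw [this, one_mul]
    calc |taylorRem l x y| ≤ 2 * K * ‖y - x‖ := hglob
      _ ≤ 2 * K * (C * nrm (x - y)) := by gcongr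
      _ = 2 * K * C * nrm (x - y) := by ring
      _ ≤ ε * nrm (x - y) + 2 * K * C * nrm (x - y) := le_add_of_nonneg_left (by positivity)
      _ ≤ _ := le_add_of_nonneg_right (by positivity)

end Gradient

section Coupling

variable {k : ℕ} {p q c : ℝ} {nrm : (Fin k → ℝ) → ℝ} {μ : Measure (Fin k → ℝ)}
  {π : Measure ((Fin k → ℝ) × (Fin k → ℝ))}

lemma memLp_of_lintegral_rpow_lt_top {α : Type*} [MeasurableSpace α] {m : Measure α} {f : α → ℝ}
    (hf : AEStronglyMeasurable f m) (h0 : ∀ x, 0 ≤ f x) (hp : 0 < p)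
    (h : ∫⁻ x, ENNReal.ofReal (f x ^ p) ∂m < ⊤) : MemLp f (ENNReal.ofReal p) m := by
  rw [← integrable_norm_rpow_iff hf (by simp [hp]) (by simp), ENNReal.toReal_ofReal hp.le]
  simp_rw [Real.norm_of_nonneg (h0 _)]
  refine ⟨(hf.aemeasurable.pow_const p).aestronglyMeasurable, ?_⟩
  rwa [hasFiniteIntegral_iff_ofReal (ae_of_all _ fun x => Real.rpow_nonneg (h0 x) p)]

/-- A coupling with first marginal `μ` whose `p`-transport cost is at most `c ^ p`. -/
structure CouplingOfCostLE (p : ℝ) (nrm : (Fin k → ℝ) → ℝ) (μ : Measure (Fin k → ℝ)) (c : ℝ)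
    (π : Measure ((Fin k → ℝ) × (Fin k → ℝ))) : Prop where
  isProbabilityMeasure : IsProbabilityMeasure π
  map_fst : π.map Prod.fst = μ
  cost_le : ∫⁻ z, ENNReal.ofReal (nrm (z.1 - z.2) ^ p) ∂π ≤ ENNReal.ofReal (c ^ p)

namespace CouplingOfCostLE

lemma memLp (hπ : CouplingOfCostLE p nrm μ c π) (hn : IsNorm nrm) (hp : 1 < p) :
    MemLp (fun z => nrm (z.1 - z.2)) (ENNReal.ofReal p) π :=
  memLp_of_lintegral_rpow_lt_top
    (hn.continuous.comp (continuous_fst.sub continuous_snd)).aestronglyMeasurable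
    (fun _ => hn.nonneg _) (by linarith) (hπ.cost_le.trans_lt ENNReal.ofReal_lt_top)

lemma integrable_rpow (hπ : CouplingOfCostLE p nrm μ c π) (hn : IsNorm nrm) (hp : 1 < p) :
    Integrable (fun z => nrm (z.1 - z.2) ^ p) π := by
  have := (hπ.memLp hn hp).integrable_norm_rpow (by simp; linarith) (by simp)
  rw [ENNReal.toReal_ofReal (by linarith)] at this
  simpa only [Real.norm_of_nonneg (hn.nonneg _)] using this

lemma integral_rpow_le (hπ : CouplingOfCostLE p nrm μ c π) (hn : IsNorm nrm) (hp : 1 < p)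
    (hc : 0 ≤ c) : ∫ z, nrm (z.1 - z.2) ^ p ∂π ≤ c ^ p := by
  rw [← ENNReal.ofReal_le_ofReal_iff (by positivity), ofReal_integral_eq_lintegral_ofReal
    (hπ.integrable_rpow hn hp) (ae_of_all _ fun z => Real.rpow_nonneg (hn.nonneg _) p)]
  exact hπ.cost_le

lemma integral_fst (hπ : CouplingOfCostLE p nrm μ c π) {g : (Fin k → ℝ) → ℝ}
    (hg : Measurable g) : ∫ z, g z.1 ∂π = ∫ x, g x ∂μ := by
  rw [← hπ.map_fst, integral_map measurable_fst.aemeasurable hg.aestronglyMeasurable]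

lemma integrable_fst_mul (hπ : CouplingOfCostLE p nrm μ c π) (hn : IsNorm nrm) (hp : 1 < p)
    {g : (Fin k → ℝ) → ℝ} (hg : Measurable g) {B : ℝ} (hB : ∀ x, |g x| ≤ B) :
    Integrable (fun z => g z.1 * nrm (z.1 - z.2)) π := by
  have := hπ.isProbabilityMeasure
  exact ((hπ.memLp hn hp).integrable (by simpa using hp.le)).bdd_mul
    (hg.comp measurable_fst).aestronglyMeasurable (ae_of_all _ fun z => hB z.1)

lemma integral_fst_mul_le (hπ : CouplingOfCostLE p nrm μ c π) (hn : IsNorm nrm)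
    (hpq : q.HolderConjugate p) (hc : 0 ≤ c) {g : (Fin k → ℝ) → ℝ} (hg : Measurable g)
    (h0 : ∀ x, 0 ≤ g x) {B : ℝ} (hB : ∀ x, g x ≤ B) :
    ∫ z, g z.1 * nrm (z.1 - z.2) ∂π ≤ (∫ x, g x ^ q ∂μ) ^ (1 / q) * c := by
  have := hπ.isProbabilityMeasure
  have hp := hpq.symm.lt
  calc ∫ z, g z.1 * nrm (z.1 - z.2) ∂π
      ≤ (∫ z, g z.1 ^ q ∂π) ^ (1 / q) * (∫ z, nrm (z.1 - z.2) ^ p ∂π) ^ (1 / p) :=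
        integral_mul_le_Lp_mul_Lq_of_nonneg hpq (ae_of_all _ fun z => h0 z.1)
          (ae_of_all _ fun z => hn.nonneg _)
          (MemLp.of_bound (hg.comp measurable_fst).aestronglyMeasurable B
            (ae_of_all _ fun z => by simpa [abs_of_nonneg (h0 _)] using hB z.1))
          (hπ.memLp hn hp)
    _ = (∫ x, g x ^ q ∂μ) ^ (1 / q) * (∫ z, nrm (z.1 - z.2) ^ p ∂π) ^ (1 / p) := by
        rw [hπ.integral_fst (g := fun x => g x ^ q) (hg.pow_const q)]
    _ ≤ (∫ x, g x ^ q ∂μ) ^ (1 / q) * (c ^ p) ^ (1 / p) := by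
        have h1 : 0 ≤ ∫ x, g x ^ q ∂μ := integral_nonneg fun x => Real.rpow_nonneg (h0 x) q
        have h2 : 0 ≤ ∫ z, nrm (z.1 - z.2) ^ p ∂π :=
          integral_nonneg fun z => Real.rpow_nonneg (hn.nonneg _) p
        have h3 := hpq.symm.pos
        gcongr
        exact hπ.integral_rpow_le hn hp hc
    _ = _ := by rw [← Real.rpow_mul hc, mul_one_div_cancel hpq.symm.ne_zero, Real.rpow_one]

variable {l : (Fin k → ℝ) → ℝ} {K : ℝ≥0}

lemma integrable_taylorRem (hπ : CouplingOfCostLE p nrm μ c π) (hn : IsNorm nrm) (hp : 1 < p)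
    (hl : ContDiff ℝ 1 l) (hlip : LipschitzWith K l) :
    Integrable (fun z => taylorRem l z.1 z.2) π := by
  obtain ⟨C, hC, hle⟩ := hn.exists_norm_le_mul
  refine (hπ.integrable_fst_mul hn hp (g := fun _ => 2 * K * C) measurable_const
    fun _ => le_rfl).mono' (continuous_taylorRem hl).aestronglyMeasurable (ae_of_all _ fun z => ?_)
  calc |taylorRem l z.1 z.2| ≤ 2 * K * ‖z.2 - z.1‖ := abs_taylorRem_le_of_lipschitz hlip _ _
    _ ≤ 2 * K * (C * nrm (z.1 - z.2)) := by
        rw [norm_sub_rev]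
        gcongr
        exact hle _
    _ = _ := by ring

lemma integrable_sub (hπ : CouplingOfCostLE p nrm μ c π) (hn : IsNorm nrm) (hp : 1 < p)
    (hlip : LipschitzWith K l) : Integrable (fun z => l z.2 - l z.1) π := by
  obtain ⟨C, hC, hle⟩ := hn.exists_norm_le_mul
  have hcont := hlip.continuous
  refine (hπ.integrable_fst_mul hn hp (g := fun _ => K * C) measurable_const
    fun _ => le_rfl).mono' (by fun_prop) (ae_of_all _ fun z => ?_)
  calc |l z.2 - l z.1| ≤ K * ‖z.2 - z.1‖ := by
        simpa [← Real.dist_eq, ← dist_eq_norm] using hlip.dist_le_mul z.2 z.1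
    _ ≤ K * (C * nrm (z.1 - z.2)) := by
        rw [norm_sub_rev]
        gcongr
        exact hle _
    _ = _ := by ring

lemma integrable_pairing_grad (hπ : CouplingOfCostLE p nrm μ c π) (hn : IsNorm nrm) (hp : 1 < p)
    (hl : ContDiff ℝ 1 l) (hlip : LipschitzWith K l) :
    Integrable (fun z => pairing (z.2 - z.1) (grad l z.1)) π := by
  have := (hπ.integrable_sub hn hp hlip).sub (hπ.integrable_taylorRem hn hp hl hlip)
  refine this.congr (ae_of_all _ fun z => ?_)
  simp [taylorRem]

lemma integral_map_snd (hπ : CouplingOfCostLE p nrm μ c π) (hn : IsNorm nrm) (hp : 1 < p)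
    (hl : ContDiff ℝ 1 l) (hlip : LipschitzWith K l) (hlμ : Integrable l μ) :
    ∫ y, l y ∂(π.map Prod.snd) = ∫ x, l x ∂μ + ∫ z, pairing (z.2 - z.1) (grad l z.1) ∂π
      + ∫ z, taylorRem l z.1 z.2 ∂π := by
  have h1 : Integrable (fun z => l z.1) π := by
    rw [← hπ.map_fst] at hlμ
    exact hlμ.comp_measurable measurable_fst
  rw [integral_map measurable_snd.aemeasurable hl.continuous.aestronglyMeasurable,
    ← hπ.integral_fst hl.continuous.measurable,
    ← integral_add h1 (hπ.integrable_pairing_grad hn hp hl hlip),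
    ← integral_add (h1.fun_add (hπ.integrable_pairing_grad hn hp hl hlip))
      (hπ.integrable_taylorRem hn hp hl hlip)]
  refine integral_congr_ae (ae_of_all _ fun z => ?_)
  simp [taylorRem]

lemma integral_pairing_grad_le (hπ : CouplingOfCostLE p nrm μ c π) (hn : IsNorm nrm)
    (hpq : q.HolderConjugate p) (hc : 0 ≤ c) (hl : ContDiff ℝ 1 l) (hlip : LipschitzWith K l)
    (hmeas : Measurable fun x => dualNorm nrm (grad l x)) :
    ∫ z, pairing (z.2 - z.1) (grad l z.1) ∂π
      ≤ (∫ x, dualNorm nrm (grad l x) ^ q ∂μ) ^ (1 / q) * c := by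
  obtain ⟨C, hC, hle⟩ := exists_dualNorm_le hn
  have hbound : ∀ x, dualNorm nrm (grad l x) ≤ C * K := fun x =>
    (hle _).trans (mul_le_mul_of_nonneg_left (norm_grad_le hlip x) hC)
  have h0 : ∀ x, 0 ≤ dualNorm nrm (grad l x) := fun x => dualNorm_nonneg hn _
  refine le_trans ?_ (hπ.integral_fst_mul_le hn hpq hc hmeas h0 hbound)
  refine integral_mono (hπ.integrable_pairing_grad hn hpq.symm.lt hl hlip)
    (hπ.integrable_fst_mul hn hpq.symm.lt hmeas
      fun x => by simpa [abs_of_nonneg (h0 x)] using hbound x) fun z => ?_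
  rw [hn.map_sub_rev]
  exact pairing_le_mul_dualNorm hn _ _

end CouplingOfCostLE

lemma exists_isCompact_measureReal_compl_le (μ : Measure (Fin k → ℝ)) [IsProbabilityMeasure μ]
    {ε : ℝ} (hε : 0 < ε) : ∃ s, IsCompact s ∧ μ.real sᶜ ≤ ε := by
  obtain ⟨s, hs, hle⟩ := isTightMeasureSet_iff_exists_isCompact_measure_compl_le.1
    (isTightMeasureSet_singleton (μ := μ)) (ENNReal.ofReal ε) (by simpa)
  exact ⟨s, hs, ENNReal.toReal_le_of_le_ofReal hε.le (hle μ rfl)⟩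

/-- The first-order expansion of `l` is uniform over couplings of vanishing cost. -/
lemma exists_abs_integral_taylorRem_le {l : (Fin k → ℝ) → ℝ} {K : ℝ≥0} [IsProbabilityMeasure μ]
    (hn : IsNorm nrm) (hpq : q.HolderConjugate p) (hl : ContDiff ℝ 1 l) (hlip : LipschitzWith K l)
    {ε : ℝ} (hε : 0 < ε) :
    ∃ c₀ > 0, ∀ c, 0 < c → c < c₀ → ∀ π, CouplingOfCostLE p nrm μ c π →
      |∫ z, taylorRem l z.1 z.2 ∂π| ≤ ε * c := by
  have hp := hpq.symm.lt
  have hq := hpq.pos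
  obtain ⟨M, hM, hrem⟩ := exists_abs_taylorRem_le hn hl hlip hp
  obtain ⟨s, hs, hμs⟩ := exists_isCompact_measureReal_compl_le μ
    (ε := (ε / 3 / (M + 1)) ^ q) (by positivity)
  obtain ⟨D, hD, hbound⟩ := hrem s hs (ε / 3) (by positivity)
  refine ⟨(ε / 3 / (D + 1)) ^ (1 / (p - 1)), by positivity, fun c hc hlt π hπ => ?_⟩
  have hms : MeasurableSet sᶜ := hs.measurableSet.compl
  have hgm : Measurable (sᶜ.indicator (1 : (Fin k → ℝ) → ℝ)) := measurable_one.indicator hms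
  have hg0 : ∀ x, 0 ≤ sᶜ.indicator (1 : (Fin k → ℝ) → ℝ) x :=
    Set.indicator_nonneg fun _ _ => zero_le_one
  have hg1 : ∀ x, sᶜ.indicator (1 : (Fin k → ℝ) → ℝ) x ≤ 1 :=
    Set.indicator_le_self' (fun _ _ => zero_le_one)
  have hinteg0 : Integrable (fun z => ε / 3 * nrm (z.1 - z.2)) π :=
    hπ.integrable_fst_mul hn hp (g := fun _ => ε / 3) measurable_const fun _ => le_rfl
  have hinteg1 : Integrable (fun z => sᶜ.indicator (1 : (Fin k → ℝ) → ℝ) z.1 * nrm (z.1 - z.2)) π :=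
    hπ.integrable_fst_mul hn hp hgm fun x => by rw [abs_of_nonneg (hg0 x)]; exact hg1 x
  have hinteg2 := hπ.integrable_rpow hn hp
  have b0 : ∫ z, ε / 3 * nrm (z.1 - z.2) ∂π ≤ ε / 3 * c := by
    have := hπ.integral_fst_mul_le hn hpq hc.le (g := fun _ => ε / 3) measurable_const
      (fun _ => by positivity) (fun _ => le_rfl)
    simpa [← Real.rpow_mul (show 0 ≤ ε / 3 by positivity), hq.ne'] using this
  have b1 : ∫ z, sᶜ.indicator (1 : (Fin k → ℝ) → ℝ) z.1 * nrm (z.1 - z.2) ∂π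
      ≤ ε / 3 / (M + 1) * c := by
    refine (hπ.integral_fst_mul_le hn hpq hc.le hgm hg0 hg1).trans ?_
    have hpow : ∀ x, sᶜ.indicator (1 : (Fin k → ℝ) → ℝ) x ^ q = sᶜ.indicator 1 x := fun x => by
      by_cases hx : x ∈ s <;> simp [hx, hq.ne']
    simp_rw [hpow]
    rw [integral_indicator_one hms]
    gcongr
    calc μ.real sᶜ ^ (1 / q) ≤ ((ε / 3 / (M + 1)) ^ q) ^ (1 / q) := by gcongr
      _ = _ := by
        rw [← Real.rpow_mul (by positivity), mul_one_div_cancel hq.ne', Real.rpow_one]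
  have b2 : ∫ z, nrm (z.1 - z.2) ^ p ∂π ≤ ε / 3 / (D + 1) * c := by
    refine (hπ.integral_rpow_le hn hp hc.le).trans ?_
    have hp1 : 0 < p - 1 := by linarith
    have : c ^ (p - 1) ≤ ε / 3 / (D + 1) := by
      calc c ^ (p - 1) ≤ ((ε / 3 / (D + 1)) ^ (1 / (p - 1))) ^ (p - 1) := by gcongr
        _ = _ := by
          rw [← Real.rpow_mul (by positivity), one_div_mul_cancel hp1.ne', Real.rpow_one]
    calc c ^ p = c ^ (p - 1) * c := by rw [Real.rpow_sub_one hc.ne']; field_simp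
      _ ≤ _ := by gcongr
  calc |∫ z, taylorRem l z.1 z.2 ∂π| ≤ ∫ z, |taylorRem l z.1 z.2| ∂π :=
        abs_integral_le_integral_abs
    _ ≤ ∫ z, ε / 3 * nrm (z.1 - z.2)
          + M * (sᶜ.indicator (1 : (Fin k → ℝ) → ℝ) z.1 * nrm (z.1 - z.2))
          + D * nrm (z.1 - z.2) ^ p ∂π :=
        integral_mono (hπ.integrable_taylorRem hn hp hl hlip).abs
          ((hinteg0.add (hinteg1.const_mul M)).add (hinteg2.const_mul D)) fun z => hbound z.1 z.2
    _ = ∫ z, ε / 3 * nrm (z.1 - z.2) ∂π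
          + M * ∫ z, sᶜ.indicator (1 : (Fin k → ℝ) → ℝ) z.1 * nrm (z.1 - z.2) ∂π
          + D * ∫ z, nrm (z.1 - z.2) ^ p ∂π := by
        rw [integral_add (hinteg0.fun_add (hinteg1.const_mul M)) (hinteg2.const_mul D),
          integral_add hinteg0 (hinteg1.const_mul M), integral_const_mul, integral_const_mul,
          integral_const_mul]
    _ ≤ ε / 3 * c + M * (ε / 3 / (M + 1) * c) + D * (ε / 3 / (D + 1) * c) := by gcongr
    _ ≤ ε / 3 * c + (M + 1) * (ε / 3 / (M + 1) * c) + (D + 1) * (ε / 3 / (D + 1) * c) := by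
        gcongr <;> linarith
    _ = ε * c := by field_simp; ring

end Coupling

section Wasserstein

variable {k : ℕ} {p q c δ : ℝ} {nrm : (Fin k → ℝ) → ℝ} {μ η : Measure (Fin k → ℝ)}
  {l : (Fin k → ℝ) → ℝ} {K : ℝ≥0}

lemma exists_couplingOfCostLE_of_Wp_lt (hp : 0 < p) (hc : 0 ≤ c)
    (h : Wp p nrm μ η < ENNReal.ofReal c) :
    ∃ π, CouplingOfCostLE p nrm μ c π ∧ π.map Prod.snd = η := by
  simp only [Wp, iInf_lt_iff] at h
  obtain ⟨π, hprob, hfst, hsnd, hlt⟩ := h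
  refine ⟨π, ⟨hprob, hfst, ?_⟩, hsnd⟩
  rw [← ENNReal.ofReal_rpow_of_nonneg hc hp.le, ← ENNReal.rpow_inv_le_iff hp, ← one_div]
  exact hlt.le

lemma CouplingOfCostLE.Wp_le {π : Measure ((Fin k → ℝ) × (Fin k → ℝ))}
    (hπ : CouplingOfCostLE p nrm μ c π) (hp : 0 < p) (hc : 0 ≤ c) :
    Wp p nrm μ (π.map Prod.snd) ≤ ENNReal.ofReal c := by
  refine (iInf_le_of_le π <| iInf_le_of_le hπ.isProbabilityMeasure <|
    iInf_le_of_le hπ.map_fst <| iInf_le_of_le rfl le_rfl).trans ?_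
  rw [one_div, ENNReal.rpow_inv_le_iff hp, ENNReal.ofReal_rpow_of_nonneg hc hp.le]
  exact hπ.cost_le

lemma LipschitzWith.integrable_of_moment [IsProbabilityMeasure μ] (hlip : LipschitzWith K l)
    (hn : IsNorm nrm) (hp : 1 < p) (hmom : ∫⁻ x, ENNReal.ofReal (nrm x ^ p) ∂μ < ⊤) :
    Integrable l μ := by
  obtain ⟨C, hC, hle⟩ := hn.exists_norm_le_mul
  have hnrm : Integrable nrm μ :=
    (memLp_of_lintegral_rpow_lt_top hn.continuous.aestronglyMeasurable hn.nonneg (by linarith)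
      hmom).integrable (by simpa using hp.le)
  refine ((integrable_const |l 0|).add (hnrm.const_mul (K * C))).mono'
    hlip.continuous.aestronglyMeasurable (ae_of_all _ fun x => ?_)
  have h1 : |l x - l 0| ≤ K * ‖x‖ := by
    simpa [← Real.dist_eq, ← dist_eq_norm] using hlip.dist_le_mul x 0
  have h2 : K * ‖x‖ ≤ K * (C * nrm x) := by gcongr; exact hle x
  calc |l x| = |l 0 + (l x - l 0)| := by ring_nf
    _ ≤ |l 0| + |l x - l 0| := abs_add_le _ _
    _ ≤ |l 0| + K * C * nrm x := by linarith

/-- If every coupling of cost slightly larger than `δ` has second marginal value at most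
`A + B * c`, then so does every measure in the Wasserstein ball of radius `δ`. -/
lemma integral_le_of_Wp_le {A B c₀ : ℝ} (hp : 0 < p) (hδ : 0 < δ) (hδc : δ < c₀)
    (hbound : ∀ c, 0 < c → c < c₀ → ∀ π, CouplingOfCostLE p nrm μ c π →
      ∫ y, l y ∂(π.map Prod.snd) ≤ A + B * c)
    (hη : Wp p nrm μ η ≤ ENNReal.ofReal δ) : ∫ y, l y ∂η ≤ A + B * δ := by
  have hlim : Tendsto (fun c => A + B * c) (nhdsWithin δ (Set.Ioi δ)) (nhds (A + B * δ)) :=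
    (Continuous.tendsto (by fun_prop) δ).mono_left nhdsWithin_le_nhds
  refine ge_of_tendsto hlim ?_
  filter_upwards [Ioo_mem_nhdsGT hδc] with c hc
  have hc0 := hδ.trans hc.1
  obtain ⟨π, hπ, rfl⟩ := exists_couplingOfCostLE_of_Wp_lt hp hc0.le
    (hη.trans_lt ((ENNReal.ofReal_lt_ofReal_iff hc0).2 hc.1))
  exact hbound c hc0 hc.2 π hπ

end Wasserstein

section SteepestAscent

variable {k : ℕ} {p q δ Υ : ℝ} {nrm : (Fin k → ℝ) → ℝ} {μ : Measure (Fin k → ℝ)}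
  {l : (Fin k → ℝ) → ℝ} {K : ℝ≥0} {h : (Fin k → ℝ) → (Fin k → ℝ)} {T : (Fin k → ℝ) → (Fin k → ℝ)}

lemma measurable_dualNorm_grad (hmeas : Measurable h)
    (hdual : ∀ y, pairing (h y) y = dualNorm nrm y) (hl : ContDiff ℝ 1 l) :
    Measurable fun x => dualNorm nrm (grad l x) := by
  simp_rw [← hdual, pairing]
  have hg := (continuous_grad hl).measurable
  exact Finset.measurable_sum _ fun i _ =>
    ((measurable_pi_apply i).comp (hmeas.comp hg)).mul ((measurable_pi_apply i).comp hg)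

lemma integrable_dualNorm_grad_rpow [IsProbabilityMeasure μ] (hn : IsNorm nrm) (hq : 0 ≤ q)
    (hlip : LipschitzWith K l) (hmeas : Measurable fun x => dualNorm nrm (grad l x)) :
    Integrable (fun x => dualNorm nrm (grad l x) ^ q) μ := by
  obtain ⟨C, hC, hle⟩ := exists_dualNorm_le hn
  refine Integrable.of_bound (hmeas.pow_const q).aestronglyMeasurable ((C * K) ^ q)
    (ae_of_all _ fun x => ?_)
  rw [Real.norm_of_nonneg (Real.rpow_nonneg (dualNorm_nonneg hn _) q)]
  exact Real.rpow_le_rpow (dualNorm_nonneg hn _)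
    ((hle _).trans (mul_le_mul_of_nonneg_left (norm_grad_le hlip x) hC)) hq

lemma measurable_steepestAscent (hmeas : Measurable h)
    (hdual : ∀ y, pairing (h y) y = dualNorm nrm y) (hl : ContDiff ℝ 1 l)
    (hT : ∀ x, T x = x + (δ * dualNorm nrm (grad l x) ^ (q - 1) * Υ ^ (1 - q)) • h (grad l x)) :
    Measurable T := by
  rw [funext hT]
  have hd := measurable_dualNorm_grad hmeas hdual hl
  exact measurable_id.add ((((hd.pow_const _).const_mul δ).mul_const _).smul
    (hmeas.comp (continuous_grad hl).measurable))

lemma norm_sub_steepestAscent (hn : IsNorm nrm) (hq : 1 < q) (hδ : 0 ≤ δ) (hΥ : 0 < Υ)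
    (hdual : ∀ y, pairing (h y) y = dualNorm nrm y) (hunit : ∀ y, y ≠ 0 → nrm (h y) = 1)
    (hT : ∀ x, T x = x + (δ * dualNorm nrm (grad l x) ^ (q - 1) * Υ ^ (1 - q)) • h (grad l x))
    (x : Fin k → ℝ) :
    nrm (x - T x) = δ * dualNorm nrm (grad l x) ^ (q - 1) * Υ ^ (1 - q) := by
  have hd := dualNorm_nonneg hn (grad l x)
  rw [hn.map_sub_rev, hT, add_sub_cancel_left, hn.smul, abs_of_nonneg (by positivity)]
  rcases eq_or_ne (grad l x) 0 with h0 | h0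
  · have : dualNorm nrm (0 : Fin k → ℝ) = 0 := by rw [← hdual]; simp [pairing]
    simp [h0, this, Real.zero_rpow (sub_ne_zero.2 hq.ne')]
  · rw [hunit _ h0, mul_one]

lemma couplingOfCostLE_steepestAscent [IsProbabilityMeasure μ] (hn : IsNorm nrm)
    (hpq : q.HolderConjugate p) (hδ : 0 ≤ δ) (hΥ : 0 < Υ)
    (hmeas : Measurable h) (hdual : ∀ y, pairing (h y) y = dualNorm nrm y)
    (hunit : ∀ y, y ≠ 0 → nrm (h y) = 1) (hl : ContDiff ℝ 1 l) (hlip : LipschitzWith K l)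
    (hinteg : ∫ x, dualNorm nrm (grad l x) ^ q ∂μ = Υ ^ q)
    (hT : ∀ x, T x = x + (δ * dualNorm nrm (grad l x) ^ (q - 1) * Υ ^ (1 - q)) • h (grad l x)) :
    CouplingOfCostLE p nrm μ δ (μ.map fun x => (x, T x)) := by
  have hTm := measurable_steepestAscent hmeas hdual hl hT
  have hgraph : Measurable fun x => (x, T x) := measurable_id.prodMk hTm
  have hd := measurable_dualNorm_grad hmeas hdual hl
  refine ⟨Measure.isProbabilityMeasure_map hgraph.aemeasurable, ?_, ?_⟩
  · rw [Measure.map_map measurable_fst hgraph]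
    exact Measure.map_id
  · have hcost : Measurable fun z : (Fin k → ℝ) × (Fin k → ℝ) =>
        ENNReal.ofReal (nrm (z.1 - z.2) ^ p) :=
      ((hn.continuous.measurable.comp (measurable_fst.sub measurable_snd)).pow_const
        p).ennreal_ofReal
    have hpow : ∀ x, nrm (x - T x) ^ p = δ ^ p * (Υ ^ q)⁻¹ * dualNorm nrm (grad l x) ^ q := by
      intro x
      have h0 := dualNorm_nonneg hn (grad l x)
      rw [norm_sub_steepestAscent hn hpq.lt hδ hΥ hdual hunit hT,
        Real.mul_rpow (by positivity) (by positivity), Real.mul_rpow hδ (by positivity),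
        ← Real.rpow_mul h0, ← Real.rpow_mul hΥ.le, hpq.sub_one_mul_conj,
        show (1 - q) * p = -q by linarith [hpq.sub_one_mul_conj], Real.rpow_neg hΥ.le]
      ring
    rw [lintegral_map hcost hgraph]
    simp_rw [hpow]
    rw [← ofReal_integral_eq_lintegral_ofReal
      ((integrable_dualNorm_grad_rpow hn hpq.nonneg hlip hd).const_mul _)
      (ae_of_all _ fun x => mul_nonneg (by positivity)
        (Real.rpow_nonneg (dualNorm_nonneg hn _) q)), integral_const_mul, hinteg,
      inv_mul_cancel_right₀ (by positivity)]

lemma integral_pairing_steepestAscent (hn : IsNorm nrm) (hq : 1 < q) (hΥ : 0 < Υ)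
    (hmeas : Measurable h) (hdual : ∀ y, pairing (h y) y = dualNorm nrm y) (hl : ContDiff ℝ 1 l)
    (hinteg : ∫ x, dualNorm nrm (grad l x) ^ q ∂μ = Υ ^ q)
    (hT : ∀ x, T x = x + (δ * dualNorm nrm (grad l x) ^ (q - 1) * Υ ^ (1 - q)) • h (grad l x)) :
    ∫ z, pairing (z.2 - z.1) (grad l z.1) ∂(μ.map fun x => (x, T x)) = Υ * δ := by
  have hTm := measurable_steepestAscent hmeas hdual hl hT
  have hcont : Continuous fun z : (Fin k → ℝ) × (Fin k → ℝ) =>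
      pairing (z.2 - z.1) (grad l z.1) := by
    have := continuous_grad hl
    unfold pairing
    fun_prop
  have hpair : ∀ x, pairing (T x - x) (grad l x)
      = δ * Υ ^ (1 - q) * dualNorm nrm (grad l x) ^ q := by
    intro x
    rw [hT, add_sub_cancel_left, pairing_smul_left, hdual]
    have : dualNorm nrm (grad l x) ^ (q - 1) * dualNorm nrm (grad l x)
        = dualNorm nrm (grad l x) ^ q := by
      have := Real.rpow_add_one' (dualNorm_nonneg hn (grad l x)) (y := q - 1) (by linarith)
      rw [← this, sub_add_cancel]
    rw [← this]
    ring
  have hgraph : Measurable fun x => (x, T x) := measurable_id.prodMk hTm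
  rw [integral_map hgraph.aemeasurable hcont.aestronglyMeasurable]
  simp_rw [hpair]
  rw [integral_const_mul, hinteg, mul_assoc, ← Real.rpow_add hΥ, sub_add_cancel, Real.rpow_one,
    mul_comm]

end SteepestAscent

theorem stmt2 {k : ℕ} (p q : ℝ) (hp : 1 < p) (hq : 1 < q) (hpq : 1 / p + 1 / q = 1)
    (nrm : (Fin k → ℝ) → ℝ) (hnrm : IsNorm nrm)
    (h : (Fin k → ℝ) → (Fin k → ℝ)) (hmeas : Measurable h)
    (hdual : ∀ y, pairing (h y) y = dualNorm nrm y)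
    (hunit : ∀ y, y ≠ 0 → nrm (h y) = 1)
    (l : (Fin k → ℝ) → ℝ) (hlip : ∃ K : ℝ≥0, LipschitzWith K l)
    (hsmooth : ContDiff ℝ 1 l)
    (μ : Measure (Fin k → ℝ)) (hμ : IsProbabilityMeasure μ)
    (hmom : ∫⁻ x, ENNReal.ofReal (nrm x ^ p) ∂μ < ⊤)
    (Υ : ℝ)
    (hΥ : Υ = (∫ x, dualNorm nrm (grad l x) ^ q ∂μ) ^ (1 / q))
    (hΥpos : 0 < Υ)
    (T : ℝ → (Fin k → ℝ) → (Fin k → ℝ))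
    (hT : ∀ δ x, T δ x =
      x + (δ * dualNorm nrm (grad l x) ^ (q - 1) * Υ ^ (1 - q)) • h (grad l x)) :
    Tendsto (fun δ : ℝ =>
        (Vrob p nrm l μ δ - ∫ x, l x ∂(μ.map (T δ))) / δ)
      (nhdsWithin 0 (Set.Ioi 0)) (nhds 0) := by
  obtain ⟨K, hlip⟩ := hlip
  have hqp : q.HolderConjugate p :=
    (Real.holderConjugate_iff.2 ⟨hp, by simpa using hpq⟩).symm
  have hd := measurable_dualNorm_grad hmeas hdual hsmooth
  have hlμ := hlip.integrable_of_moment hnrm hp hmom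
  have hinteg : ∫ x, dualNorm nrm (grad l x) ^ q ∂μ = Υ ^ q := by
    rw [hΥ, ← Real.rpow_mul (integral_nonneg fun x => Real.rpow_nonneg (dualNorm_nonneg hnrm _) q),
      one_div_mul_cancel hqp.ne_zero, Real.rpow_one]
  rw [Metric.tendsto_nhdsWithin_nhds]
  intro ε hε
  obtain ⟨c₀, hc₀, hrem⟩ := exists_abs_integral_taylorRem_le (μ := μ) hnrm hqp hsmooth hlip
    (ε := ε / 3) (by positivity)
  refine ⟨c₀, hc₀, fun {δ} hδ hδc => ?_⟩
  have hδ0 : 0 < δ := hδ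
  rw [Real.dist_0_eq_abs, abs_of_pos hδ0] at hδc
  have hupper : ∀ η : Measure (Fin k → ℝ), Wp p nrm μ η ≤ ENNReal.ofReal δ →
      ∫ y, l y ∂η ≤ ∫ x, l x ∂μ + (Υ + ε / 3) * δ := fun η hη => by
    refine integral_le_of_Wp_le (by linarith) hδ0 hδc (fun c hc hcc π hπ => ?_) hη
    have h1 := hπ.integral_pairing_grad_le hnrm hqp hc.le hsmooth hlip hd
    rw [← hΥ] at h1
    rw [hπ.integral_map_snd hnrm hp hsmooth hlip hlμ]
    linarith [(abs_le.1 (hrem c hc hcc π hπ)).2]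
  have hπ := couplingOfCostLE_steepestAscent (μ := μ) hnrm hqp hδ0.le hΥpos hmeas hdual hunit
    hsmooth hlip hinteg (hT δ)
  have hTm := measurable_steepestAscent hmeas hdual hsmooth (hT δ)
  have hsnd : (μ.map fun x => (x, T δ x)).map Prod.snd = μ.map (T δ) :=
    Measure.map_map measurable_snd (measurable_id.prodMk hTm)
  have hlower := hπ.integral_map_snd hnrm hp hsmooth hlip hlμ
  rw [hsnd, integral_pairing_steepestAscent hnrm hq hΥpos hmeas hdual hsmooth hinteg (hT δ)]
    at hlower
  have hW := hπ.Wp_le (by linarith) hδ0.le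
  rw [hsnd] at hW
  have hmem : ∫ x, l x ∂(μ.map (T δ)) ∈ {r | ∃ η : Measure (Fin k → ℝ), IsProbabilityMeasure η ∧
      Wp p nrm μ η ≤ ENNReal.ofReal δ ∧ r = ∫ x, l x ∂η} :=
    ⟨_, Measure.isProbabilityMeasure_map hTm.aemeasurable, hW, rfl⟩
  have hub : ∫ x, l x ∂μ + (Υ + ε / 3) * δ ∈ upperBounds {r | ∃ η : Measure (Fin k → ℝ),
      IsProbabilityMeasure η ∧ Wp p nrm μ η ≤ ENNReal.ofReal δ ∧ r = ∫ x, l x ∂η} := by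
    rintro r ⟨η, -, hη, rfl⟩
    exact hupper η hη
  have hV1 : ∫ x, l x ∂(μ.map (T δ)) ≤ Vrob p nrm l μ δ := le_csSup ⟨_, hub⟩ hmem
  have hV2 : Vrob p nrm l μ δ ≤ ∫ x, l x ∂μ + (Υ + ε / 3) * δ := csSup_le ⟨_, hmem⟩ hub
  have hR := (abs_le.1 (hrem δ hδ0 hδc _ hπ)).1
  rw [Real.dist_0_eq_abs, abs_of_nonneg (div_nonneg (by linarith) hδ0.le), div_lt_iff₀ hδ0]
  nlinarith [mul_pos hε hδ0]
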